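/- Let κ be a kernel on S and ν ∈ [0,∞)^S, and set θ_s = ν_s e^{−(κν)_s} for s ∈ S. Call ν' ∈ [0,∞)^S a solution of the characteristic equation (with respect to ν) if ν'_s e^{−(κν')_s} = ν_s e^{−(κν)_s} for every s ∈ S. Then among the solutions ν' with ν' ≤ ν componentwise there is a pointwise-smallest one, ν*, and for every r ∈ S the series ∑_{k∈ℕ₀^S} τ(k;κ) k_r ∏_{s∈S} θ_s^{k_s}/k_s! converges with sum equal to ν*_r. -/

import Mathlib

open scoped Classical ENNReal
open Filter MeasureTheory

noncomputable section

/-- The set of ordered pairs `(i,j)` of vertices with `i < j`, representing the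
potential edges of a graph on `Fin n`. -/
def upperPairs (n : ℕ) : Finset (Fin n × Fin n) :=
  Finset.univ.filter fun q => q.1 < q.2

/-- The simple graph on `Fin n` determined by a finite set of (ordered) edges. -/
def graphOf {n : ℕ} (E : Finset (Fin n × Fin n)) : SimpleGraph (Fin n) :=
  SimpleGraph.fromRel fun i j => (i, j) ∈ E

/-- `PConn n x p` is the probability that the inhomogeneous random graph `G(n, x, p)`,
with type vector `x` and independent edges where `{i,j}` is present with probability
`p (x i) (x j)`, is connected; written as a finite sum over connected graphs. -/
def PConn {S : Type*} (n : ℕ) (x : Fin n → S) (p : S → S → ℝ) : ℝ :=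
  ∑ E ∈ (upperPairs n).powerset.filter (fun E => (graphOf E).Connected),
    (∏ q ∈ E, p (x q.1) (x q.2)) * ∏ q ∈ upperPairs n \ E, (1 - p (x q.1) (x q.2))

/-- Sum over all spanning trees (connected graphs with `n - 1` edges) on `Fin n` of the
product of the kernel over the edges. -/
def treeWeight {S : Type*} (n : ℕ) (x : Fin n → S) (κ : S → S → ℝ) : ℝ :=
  ∑ E ∈ (upperPairs n).powerset.filter
      (fun E => (graphOf E).Connected ∧ E.card + 1 = n),
    ∏ q ∈ E, κ (x q.1) (x q.2)

/-- A canonical list of types compatible with the multiplicity vector `k`. -/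
def compatList {S : Type*} [Fintype S] (k : S → ℕ) : List S :=
  (∑ s : S, (k s) • ({s} : Multiset S)).toList

lemma compatList_length {S : Type*} [Fintype S] (k : S → ℕ) :
    (compatList k).length = ∑ s : S, k s := by
  simp [compatList]

/-- A canonical type vector compatible with `k`, i.e. with `∑ i δ_{x i} = k`. -/
def compatVec {S : Type*} [Fintype S] (k : S → ℕ) : Fin (∑ s : S, k s) → S :=
  fun i => (compatList k).get (Fin.cast (compatList_length k).symm i)

/-- `tau κ k` is the spanning-tree weight `τ(k; κ)`. -/
def tau {S : Type*} [Fintype S] (κ : S → S → ℝ) (k : S → ℕ) : ℝ :=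
  treeWeight (∑ s : S, k s) (compatVec k) κ

/-- `pN κN N k` is the probability that the inhomogeneous random graph on a vertex set
with type composition `k` and edge probabilities `min 1 (κN/N)` is connected. -/
def pN {S : Type*} [Fintype S] (κN : S → S → ℝ) (N : ℕ) (k : S → ℕ) : ℝ :=
  PConn (∑ s : S, k s) (compatVec k) fun r s => min 1 (κN r s / N)

/-- Extended-real logarithm, with `elog x = -∞` for `x ≤ 0`. -/
def elog (x : ℝ) : EReal := if x ≤ 0 then (⊥ : EReal) else ((Real.log x : ℝ) : EReal)

/-- The nonnegative part of `-log u`, equal to `∞` if `u ≤ 0`. -/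
def negLogPart (u : ℝ) : ℝ≥0∞ := if u ≤ 0 then ⊤ else ENNReal.ofReal (-Real.log u)

/-- The relative-entropy summand `x log (x / d)` with conventions `0 log 0 = 0` and
`x log (x/0) = +∞` for `x ≠ 0`. -/
def entTerm (x d : ℝ) : EReal :=
  if x = 0 then (0 : EReal) else if d ≤ 0 then (⊤ : EReal)
  else ((x * Real.log (x / d) : ℝ) : EReal)

/-- `‖κ‖_∞ = max_{r,s} κ r s`. -/
def kernelSup {S : Type*} [Fintype S] [Nonempty S] (κ : S → S → ℝ) : ℝ :=
  Finset.univ.sup' Finset.univ_nonempty fun r =>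
    Finset.univ.sup' Finset.univ_nonempty fun s => κ r s

/-- `Σ(κ, ν)`, the `ℓ²(ν)`-operator norm of the matrix `(κ r s * ν s)_{r,s}`. -/
def sigmaOp {S : Type*} [Fintype S] (κ : S → S → ℝ) (ν : S → ℝ) : ℝ :=
  sSup { t : ℝ | ∃ f : S → ℝ, (∀ s, 0 ≤ f s) ∧ (∑ r : S, ν r * f r ^ 2) ≤ 1 ∧
    t = Real.sqrt (∑ r : S, ν r * (∑ s : S, κ r s * f s * ν s) ^ 2) }

/-- Irreducibility of the kernel `κ` with respect to `ν`. -/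
def Irred {S : Type*} (κ : S → S → ℝ) (ν : S → ℝ) : Prop :=
  ∀ A : Set S, (∀ r ∈ A, ∀ s, s ∉ A → 0 < ν r → 0 < ν s → κ r s = 0) →
    (∀ r ∈ A, ν r = 0) ∨ (∀ s, s ∉ A → ν s = 0)

/-- The generating series `Γ_r(θ) = ∑_k τ(k) k_r ∏_s θ_s^{k_s}/k_s! ∈ [0,∞]`. -/
def Gamma0 {S : Type*} [Fintype S] (κ : S → S → ℝ) (θ : S → ℝ) (r : S) : ℝ≥0∞ :=
  ∑' k : S → ℕ,
    ENNReal.ofReal (tau κ k * (k r : ℝ) * ∏ s : S, θ s ^ (k s) / (Nat.factorial (k s) : ℝ))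

/-- `χ(κ, θ)`: the infimum over probability vectors `w ≪ θ` of
`∑_r w_r log (w_r / ((κ w)_r θ_r))`. -/
def chiFn {S : Type*} [Fintype S] (κ : S → S → ℝ) (θ : S → ℝ) : EReal :=
  sInf { v : EReal | ∃ w : S → ℝ, (∀ r, 0 ≤ w r) ∧ ((∑ r : S, w r) = 1) ∧
    (∀ r, θ r = 0 → w r = 0) ∧
    v = ∑ r : S, entTerm (w r) ((∑ s : S, κ r s * w s) * θ r) }

/-- `Δ_r(k)`: the sum over directed spanning trees of the support of `k` rooted at `r`
(encoded as parent maps `f`, edges `(f s, s)` directed away from the root) of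
`∏ κ(f s, s) * k (f s)`. -/
def Delta {S : Type*} [Fintype S] [DecidableEq S] (κ : S → S → ℝ) (k : S → ℕ) (r : S) : ℝ :=
  ∑ f ∈ (Finset.univ : Finset (S → S)).filter (fun f =>
      (∀ s, (s = r ∨ k s = 0) → f s = s) ∧
      ∀ s, 0 < k s → s ≠ r → (0 < k (f s) ∧ ∃ n, f^[n] s = r)),
    ∏ s ∈ Finset.univ.filter (fun s => 0 < k s ∧ s ≠ r), (κ (f s) s * (k (f s) : ℝ))

/-- The reference weight `τ(k) ∏_s μ_s^{k_s}/k_s!`. -/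
def rhoMu {S : Type*} [Fintype S] (κ : S → S → ℝ) (μ : S → ℝ) (k : S → ℕ) : ℝ :=
  tau κ k * ∏ s : S, μ s ^ (k s) / (Nat.factorial (k s) : ℝ)

/-- The microscopic rate function `I_Mi`. -/
def IMi {S : Type*} [Fintype S] (κ : S → S → ℝ) (μ : S → ℝ) (lam : (S → ℕ) → ℝ) : EReal :=
  (∑' k : S → ℕ, entTerm (lam k) (rhoMu κ μ k))
  + ((∑' k : S → ℕ, lam k * (((∑ s : S, k s : ℕ) : ℝ) - 1) : ℝ) : EReal)
  + ((((1 : ℝ)/2) * ∑ r : S, ∑ s : S, (∑' k : S → ℕ, lam k * (k r : ℝ)) * κ r s * μ s : ℝ) : EReal)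

/-- The minimizer candidate `λ_k(c) = τ(k) ∏_s (c_s e^{-(κ c)_s})^{k_s}/k_s!`. -/
def lamC {S : Type*} [Fintype S] (κ : S → S → ℝ) (c : S → ℝ) (k : S → ℕ) : ℝ :=
  tau κ k * ∏ s : S, (c s * Real.exp (-(∑ t : S, κ s t * c t))) ^ (k s) / (Nat.factorial (k s) : ℝ)

/-- The mesoscopic rate function `I_Me`. -/
def IMe {S : Type*} [Fintype S] (κ : S → S → ℝ) (μ ν : S → ℝ) : EReal :=
  (∑ r : S, entTerm (ν r) ((∑ s : S, κ r s * ν s) * μ r))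
  + ((((1 : ℝ)/2) * ∑ r : S, ∑ s : S, ν r * κ r s * μ s : ℝ) : EReal)

/-- `b` is a solution of the fixed-point system for `c`:
`b ∈ [0,∞)^S`, `b ≤ c` and `(κ(c-b))_r b_r = c_r - b_r` for all `r`. -/
def IsFPSol {S : Type*} [Fintype S] (κ : S → S → ℝ) (c b : S → ℝ) : Prop :=
  (∀ r, 0 ≤ b r) ∧ (∀ r, b r ≤ c r) ∧
    ∀ r, (∑ s : S, κ r s * (c s - b s)) * b r = c r - b r

/-- The macroscopic rate summand `f_Ma`. -/
def fMa {S : Type*} [Fintype S] (κ : S → S → ℝ) (μ y : S → ℝ) : EReal :=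
  (∑ r : S, entTerm (y r) ((1 - Real.exp (-(∑ s : S, κ r s * y s))) * μ r))
  + ((((1 : ℝ)/2) * ∑ r : S, ∑ s : S, y r * κ r s * (μ s - y s) : ℝ) : EReal)

/-- The functional `G_c(b)`. -/
def Gc {S : Type*} [Fintype S] (κ : S → S → ℝ) (μ c b : S → ℝ) : EReal :=
  (((∑ r : S, b r * Real.log (b r / μ r))
      - (1/2) * ∑ r : S, ∑ s : S, b r * κ r s * b s
      + (1/2) * ∑ r : S, ∑ s : S, c r * κ r s * μ s : ℝ) : EReal)
  + ∑ r : S, entTerm (c r - b r) ((∑ s : S, κ r s * (c s - b s)) * μ r)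

/-- `λ_k(t) = t^{|k|-1} τ(k) e^{-t⟨k,κμ⟩} ∏_r μ_r^{k_r}/k_r!`. -/
def lamT {S : Type*} [Fintype S] (κ : S → S → ℝ) (μ : S → ℝ) (k : S → ℕ) (t : ℝ) : ℝ :=
  t ^ ((∑ s : S, k s) - 1) * tau κ k *
    Real.exp (-t * ∑ r : S, ∑ s : S, (k r : ℝ) * κ r s * μ s) *
    ∏ r : S, μ r ^ (k r) / (Nat.factorial (k r) : ℝ)

section
open Finset
theorem an_bound {S : Type*} [Fintype S] (κ : S → S → ℝ) (hκ0 : ∀ r s, 0 ≤ κ r s)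
    (θ : S → ℝ) (hθ : ∀ s, 0 ≤ θ s) (c : ℕ → S → ℝ) (hc : ∀ n r, 0 ≤ c n r) (hc0 : ∀ r, c 0 r = θ r)
    (hrec : ∀ (n : ℕ) (r : S), ((n:ℝ) + 1) * c (n+1) r =
      ∑ p ∈ antidiagonal n, c p.1 r * (((p.2:ℝ) + 1) * ∑ s, κ r s * c p.2 s))
    (N : ℕ) (r : S) :
    ∑ n ∈ range (N+1), c n r ≤ θ r * Real.exp (∑ s, κ r s * ∑ n ∈ range N, c n s) := by
  set Q : ℝ → ℝ := fun t => ∑ n ∈ range (N+1), c n r * t ^ n with hQ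
  set P : ℝ → ℝ := fun t => ∑ s, κ r s * ∑ n ∈ range N, c n s * t ^ (n+1) with hP
  set Q' : ℝ → ℝ := fun t => ∑ n ∈ range (N+1), c n r * ((n:ℝ) * t ^ (n-1)) with hQ'
  set P' : ℝ → ℝ := fun t => ∑ s, κ r s * ∑ n ∈ range N, c n s * (((n:ℝ)+1) * t ^ n) with hP'
  have dQ : ∀ t, HasDerivAt Q (Q' t) t := fun t => by
    refine HasDerivAt.fun_sum fun n _ => (hasDerivAt_pow n t).const_mul _
  have dP : ∀ t, HasDerivAt P (P' t) t := fun t => by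
    refine HasDerivAt.fun_sum fun s _ => HasDerivAt.const_mul _ <|
      HasDerivAt.fun_sum fun n _ => ?_
    simpa using (hasDerivAt_pow (n+1) t).const_mul (c n s)
  have key : ∀ t, 0 ≤ t → Q' t ≤ Q t * P' t := by
    intro t ht
    have e1 : Q' t = ∑ n ∈ range N, ∑ p ∈ antidiagonal n,
        (c p.1 r * t ^ p.1) * ∑ s, κ r s * (c p.2 s * (((p.2:ℝ)+1) * t ^ p.2)) := by
      simp only [hQ']
      rw [sum_range_succ']
      simp only [Nat.cast_zero, zero_mul, mul_zero, add_zero, Nat.add_sub_cancel, Nat.cast_add, Nat.cast_one]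
      refine sum_congr rfl fun n _ => ?_
      have := hrec n r
      rw [← mul_assoc, mul_comm (c (n+1) r), this, sum_mul]
      refine sum_congr rfl fun p hp => ?_
      rw [← mem_antidiagonal.1 hp, pow_add]
      simp only [mul_sum, sum_mul]
      exact sum_congr rfl fun s _ => by ring
    have e2 : P' t = ∑ m ∈ range N, ∑ s, κ r s * (c m s * (((m:ℝ)+1) * t ^ m)) := by
      simp only [hP', mul_sum]
      rw [sum_comm]
    have nn : ∀ m, 0 ≤ ∑ s, κ r s * (c m s * (((m:ℝ)+1) * t ^ m)) := fun m =>
      sum_nonneg fun s _ => mul_nonneg (hκ0 _ _) (mul_nonneg (hc _ _) (by positivity))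
    rw [e1, e2]
    simp only [hQ]
    rw [sum_mul_sum, ← sum_product', sum_sigma']
    have inj : Set.InjOn (fun q : (Σ _ : ℕ, ℕ × ℕ) => q.2) ((range N).sigma fun n => antidiagonal n : Finset _) := by
      rintro ⟨n, p⟩ h ⟨n', p'⟩ h' e
      simp at h h' e
      subst e
      obtain ⟨_, h⟩ := h; obtain ⟨_, h'⟩ := h'
      subst h; subst h'; rfl
    rw [← sum_image (g := fun q : (Σ _ : ℕ, ℕ × ℕ) => q.2) (f := fun p : ℕ × ℕ => (c p.1 r * t ^ p.1) * ∑ s, κ r s * (c p.2 s * (((p.2:ℝ)+1) * t ^ p.2))) inj]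
    refine sum_le_sum_of_subset_of_nonneg ?_ ?_
    · rintro ⟨l, m⟩ h
      simp at h ⊢
      omega
    · intro p _ _
      exact mul_nonneg (mul_nonneg (hc _ _) (by positivity)) (nn _)
  have anti : AntitoneOn (fun t => Q t * Real.exp (-P t)) (Set.Icc 0 1) := by
    have d : ∀ t, HasDerivAt (fun t => Q t * Real.exp (-P t))
        (Q' t * Real.exp (-P t) + Q t * (Real.exp (-P t) * (-P' t))) t := fun t =>
      (dQ t).mul ((dP t).neg.exp)
    refine antitoneOn_of_deriv_nonpos (convex_Icc 0 1) (fun t _ => (d t).continuousAt.continuousWithinAt)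
      (fun t _ => (d t).differentiableAt.differentiableWithinAt) ?_
    intro t ht
    rw [interior_Icc] at ht
    rw [(d t).deriv]
    have := mul_le_mul_of_nonneg_right (key t ht.1.le) (Real.exp_pos (-P t)).le
    nlinarith
  have h := anti (by simp : (0:ℝ) ∈ Set.Icc (0:ℝ) 1) (by simp : (1:ℝ) ∈ Set.Icc (0:ℝ) 1) zero_le_one
  have hQ0 : Q 0 = θ r := by simp [hQ, sum_range_succ', hc0]
  have hP0 : P 0 = 0 := by simp [hP]
  have hQ1 : Q 1 = ∑ n ∈ range (N+1), c n r := by simp [hQ]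
  have hP1 : P 1 = ∑ s, κ r s * ∑ n ∈ range N, c n s := by simp [hP]
  simp only [hQ0, hP0, hQ1, hP1] at h
  simp only [neg_zero, Real.exp_zero, mul_one] at h
  rwa [Real.exp_neg, ← div_eq_mul_inv, div_le_iff₀ (Real.exp_pos _)] at h

theorem an_partial {S : Type*} [Fintype S] (κ : S → S → ℝ) (hκ0 : ∀ r s, 0 ≤ κ r s)
    (θ : S → ℝ) (hθ : ∀ s, 0 ≤ θ s) (c : ℕ → S → ℝ) (hc : ∀ n r, 0 ≤ c n r) (hc0 : ∀ r, c 0 r = θ r)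
    (hrec : ∀ (n : ℕ) (r : S), ((n:ℝ) + 1) * c (n+1) r =
      ∑ p ∈ antidiagonal n, c p.1 r * (((p.2:ℝ) + 1) * ∑ s, κ r s * c p.2 s))
    (ν : S → ℝ) (hν0 : ∀ r, 0 ≤ ν r) (hν : ∀ r, ν r = θ r * Real.exp (∑ s, κ r s * ν s))
    (N : ℕ) : ∀ r, ∑ n ∈ range N, c n r ≤ ν r := by
  induction N with
  | zero => simpa using hν0
  | succ N ih =>
    intro r
    refine (an_bound κ hκ0 θ hθ c hc hc0 hrec N r).trans ?_
    rw [hν r]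
    refine mul_le_mul_of_nonneg_left (Real.exp_le_exp.2 ?_) (hθ r)
    exact sum_le_sum fun s _ => mul_le_mul_of_nonneg_left (ih s) (hκ0 _ _)

theorem an_fix {S : Type*} [Fintype S] (κ : S → S → ℝ) 
    (θ : S → ℝ) (c : ℕ → S → ℝ) (hc : ∀ n r, 0 ≤ c n r) (hc0 : ∀ r, c 0 r = θ r)
    (hrec : ∀ (n : ℕ) (r : S), ((n:ℝ) + 1) * c (n+1) r =
      ∑ p ∈ antidiagonal n, c p.1 r * (((p.2:ℝ) + 1) * ∑ s, κ r s * c p.2 s))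
    (hs : ∀ r, Summable fun n => c n r) (r : S) :
    ∑' n, c n r = θ r * Real.exp (∑ s, κ r s * ∑' n, c n s) := by
  -- derivative of power series
  have sumt : ∀ s, ∀ t : ℝ, |t| < 1 → Summable fun n => ‖c n s * t ^ n‖ := by
    intro s t ht
    refine Summable.of_nonneg_of_le (fun _ => norm_nonneg _) (fun n => ?_) (hs s)
    rw [norm_mul, norm_pow, Real.norm_eq_abs, Real.norm_eq_abs, abs_of_nonneg (hc _ _)]
    exact mul_le_of_le_one_right (hc _ _) (pow_le_one₀ (abs_nonneg _) ht.le)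
  have cb : ∀ s, ∃ B, ∀ n, c n s ≤ B := by
    intro s
    exact ⟨∑' n, c n s, fun n => (hs s).le_tsum n (fun _ _ => hc _ _)⟩
  have sumd : ∀ s, ∀ t : ℝ, |t| < 1 → Summable fun n : ℕ => ‖c n s * (((n:ℝ)+1) * t ^ n)‖ := by
    intro s t ht
    obtain ⟨B, hB⟩ := cb s
    have h1 : Summable fun n : ℕ => B * (((n:ℝ)+1) * |t| ^ n) := by
      refine Summable.mul_left _ ?_
      have a1 := summable_pow_mul_geometric_of_norm_lt_one 1 (r := |t|) (by simpa using ht)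
      have a0 := summable_pow_mul_geometric_of_norm_lt_one 0 (r := |t|) (by simpa using ht)
      refine (a1.add a0).congr fun n => by simp; ring
    refine Summable.of_nonneg_of_le (fun _ => norm_nonneg _) (fun n => ?_) h1
    rw [norm_mul, norm_mul, norm_pow, Real.norm_eq_abs, Real.norm_eq_abs, Real.norm_eq_abs, abs_of_nonneg (hc _ _), abs_of_nonneg (by positivity : (0:ℝ) ≤ n+1)]
    exact mul_le_mul_of_nonneg_right (hB n) (by positivity)
  have dF : ∀ s, ∀ t : ℝ, |t| < 1 → HasDerivAt (fun t => ∑' n, c n s * t ^ (n+1))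
      (∑' n : ℕ, c n s * (((n:ℝ)+1) * t ^ n)) t := by
    intro s t ht
    obtain ⟨ρ, h1, h2⟩ := exists_between ht
    have hρ : 0 ≤ ρ := (abs_nonneg _).trans h1.le
    refine hasDerivAt_tsum_of_isPreconnected (g := fun n y => c n s * y ^ (n+1)) (g' := fun (n : ℕ) y => c n s * (((n:ℝ)+1) * y ^ n)) (u := fun n => c n s * (((n:ℝ)+1) * ρ ^ n)) (t := Set.Ioo (-ρ) ρ) (y₀ := 0) ?_ isOpen_Ioo isPreconnected_Ioo ?_ ?_ ?_ ?_ ?_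
    · exact (sumd s ρ (by rwa [abs_of_nonneg hρ])).of_norm
    · intro n y _
      simpa using (hasDerivAt_pow (n+1) y).const_mul (c n s)
    · intro n y hy
      rw [norm_mul, norm_mul, norm_pow, Real.norm_eq_abs, Real.norm_eq_abs, Real.norm_eq_abs, abs_of_nonneg (hc _ _), abs_of_nonneg (by positivity : (0:ℝ) ≤ n+1)]
      have : |y| ≤ ρ := abs_le.2 ⟨hy.1.le, hy.2.le⟩
      have := hc n s
      gcongr
    · constructor <;> linarith [abs_nonneg t, h1]
    · simp
    · exact abs_lt.1 h1
  set F : S → ℝ → ℝ := fun s t => ∑' n, c n s * t ^ (n+1) with hF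
  set F' : S → ℝ → ℝ := fun s t => ∑' n : ℕ, c n s * (((n:ℝ)+1) * t ^ n) with hF'
  set G : ℝ → ℝ := fun t => ∑' n, c n r * t ^ n with hG
  have dG : ∀ t : ℝ, |t| < 1 → HasDerivAt G (G t * ∑ s, κ r s * F' s t) t := by
    intro t ht
    obtain ⟨ρ, h1, h2⟩ := exists_between ht
    have hρ : 0 ≤ ρ := (abs_nonneg _).trans h1.le
    -- product
    have prod : G t * ∑ s, κ r s * F' s t = ∑' n : ℕ, ((n:ℝ)+1) * c (n+1) r * t ^ n := by
      have e : ∑ s, κ r s * F' s t = ∑' m : ℕ, ∑ s, κ r s * (c m s * (((m:ℝ)+1) * t ^ m)) := by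
        rw [Summable.tsum_finsetSum (fun s _ => ((sumd s t ht).of_norm).mul_left _)]
        exact sum_congr rfl fun s _ => by rw [tsum_mul_left]
      rw [e, hG]
      have sn : Summable fun m : ℕ => ‖∑ s, κ r s * (c m s * (((m:ℝ)+1) * t ^ m))‖ := by
        refine Summable.of_nonneg_of_le (fun _ => norm_nonneg _) (fun m => norm_sum_le _ _) ?_
        refine summable_sum fun s _ => ?_
        simp_rw [norm_mul (κ r s)]
        exact (sumd s t ht).mul_left _
      simp only
      rw [tsum_mul_tsum_eq_tsum_sum_antidiagonal_of_summable_norm (sumt r t ht) sn]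
      refine tsum_congr fun n => ?_
      rw [hrec, sum_mul]
      refine sum_congr rfl fun p hp => ?_
      rw [← mem_antidiagonal.1 hp, pow_add]
      simp only [mul_sum, sum_mul]
      exact sum_congr rfl fun s _ => by ring
    rw [prod]
    have hd : ∀ t : ℝ, |t| < 1 → Summable fun n : ℕ => ‖((n:ℝ)+1) * c (n+1) r * t ^ n‖ := by
      intro t ht
      obtain ⟨B, hB⟩ := cb r
      have h1 : Summable fun n : ℕ => B * (((n:ℝ)+1) * |t| ^ n) := by
        refine Summable.mul_left _ ?_
        have a1 := summable_pow_mul_geometric_of_norm_lt_one 1 (r := |t|) (by simpa using ht)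
        have a0 := summable_pow_mul_geometric_of_norm_lt_one 0 (r := |t|) (by simpa using ht)
        refine (a1.add a0).congr fun n => by simp; ring
      refine Summable.of_nonneg_of_le (fun _ => norm_nonneg _) (fun n => ?_) h1
      rw [norm_mul, norm_mul, norm_pow, Real.norm_eq_abs, Real.norm_eq_abs, Real.norm_eq_abs, abs_of_nonneg (hc _ _), abs_of_nonneg (by positivity : (0:ℝ) ≤ n+1)]
      calc _ = c (n+1) r * (((n:ℝ)+1) * |t|^n) := by ring
        _ ≤ _ := mul_le_mul_of_nonneg_right (hB _) (by positivity)
    have hG2 : G =ᶠ[nhds t] fun t => c 0 r + ∑' n, c (n+1) r * t ^ (n+1) := by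
      have : {t : ℝ | |t| < 1} ∈ nhds t := (isOpen_lt continuous_abs continuous_const).mem_nhds ht
      filter_upwards [this] with y hy
      simp only [hG]
      rw [(sumt r y hy).of_norm.tsum_eq_zero_add]; simp
    refine HasDerivAt.congr_of_eventuallyEq ?_ hG2
    refine HasDerivAt.const_add _ ?_
    refine hasDerivAt_tsum_of_isPreconnected (g := fun n y => c (n+1) r * y ^ (n+1)) (g' := fun (n : ℕ) y => ((n:ℝ)+1) * c (n+1) r * y ^ n) (u := fun n : ℕ => ((n:ℝ)+1) * c (n+1) r * ρ ^ n) (t := Set.Ioo (-ρ) ρ) (y₀ := 0) ?_ isOpen_Ioo isPreconnected_Ioo ?_ ?_ ?_ ?_ ?_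
    · exact (hd ρ (by rwa [abs_of_nonneg hρ])).of_norm
    · intro n y _
      have := (hasDerivAt_pow (n+1) y).const_mul (c (n+1) r)
      simp at this
      exact this.congr_deriv (by ring)
    · intro n y hy
      rw [norm_mul, norm_mul, norm_pow, Real.norm_eq_abs, Real.norm_eq_abs, Real.norm_eq_abs, abs_of_nonneg (hc _ _), abs_of_nonneg (by positivity : (0:ℝ) ≤ n+1)]
      have : |y| ≤ ρ := abs_le.2 ⟨hy.1.le, hy.2.le⟩
      have := hc (n+1) r
      gcongr
    · constructor <;> linarith [abs_nonneg t, h1]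
    · simp
    · exact abs_lt.1 h1
  have cst : ∀ t ∈ Set.Ioo (-1:ℝ) 1, G t = θ r * Real.exp (∑ s, κ r s * F s t) := by
    intro t ht
    have d : ∀ t ∈ Set.Ioo (-1:ℝ) 1, HasDerivAt (fun t => G t * Real.exp (-∑ s, κ r s * F s t)) 0 t := by
      intro t ht
      have ht' := abs_lt.2 ht
      have h := (dG t ht').mul (HasDerivAt.exp (HasDerivAt.neg (HasDerivAt.fun_sum (u := univ) fun s _ => (dF s t ht').const_mul (κ r s))))
      refine h.congr_deriv ?_
      simp only [hF, hF', hG]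
      ring
    have := (convex_Ioo (-1:ℝ) 1).is_const_of_fderivWithin_eq_zero (𝕜 := ℝ) (f := fun t => G t * Real.exp (-∑ s, κ r s * F s t))
      (fun t ht => (d t ht).differentiableAt.differentiableWithinAt) (fun t ht => by
        rw [fderivWithin_of_isOpen isOpen_Ioo ht]
        ext; simp [(d t ht).deriv]) ht (by simp : (0:ℝ) ∈ Set.Ioo (-1:ℝ) 1)
    have hF0 : ∀ s, F s 0 = 0 := fun s => by simp [hF]
    have hG0 : G 0 = θ r := by
      simp only [hG]
      rw [tsum_eq_single 0]
      · simp [hc0]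
      · intro n hn; simp [hn]
    simp only [hF0, hG0, mul_zero, sum_const_zero, neg_zero, Real.exp_zero, mul_one] at this
    rw [← this, mul_assoc, ← Real.exp_add]; simp
  have cG : ContinuousOn G (Set.Icc 0 1) := by
    refine continuousOn_tsum (fun n => by fun_prop) (hs r) ?_
    intro n t ht
    rw [norm_mul, norm_pow, Real.norm_eq_abs, Real.norm_eq_abs, abs_of_nonneg (hc _ _), abs_of_nonneg ht.1]
    exact mul_le_of_le_one_right (hc _ _) (pow_le_one₀ ht.1 ht.2)
  have cF : ∀ s, ContinuousOn (F s) (Set.Icc 0 1) := by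
    intro s
    refine continuousOn_tsum (fun n => by fun_prop) (hs s) ?_
    intro n t ht
    rw [norm_mul, norm_pow, Real.norm_eq_abs, Real.norm_eq_abs, abs_of_nonneg (hc _ _), abs_of_nonneg ht.1]
    exact mul_le_of_le_one_right (hc _ _) (pow_le_one₀ ht.1 ht.2)
  have cR : ContinuousOn (fun t => θ r * Real.exp (∑ s, κ r s * F s t)) (Set.Icc 0 1) := by
    refine continuousOn_const.mul (ContinuousOn.rexp ?_)
    exact continuousOn_finsetSum _ fun s _ => continuousOn_const.mul (cF s)
  have eq : Set.EqOn G (fun t => θ r * Real.exp (∑ s, κ r s * F s t)) (Set.Icc 0 1) := by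
    refine Set.EqOn.of_subset_closure (s := Set.Ico 0 1) (fun t ht => cst t ⟨by linarith [ht.1], ht.2⟩) cG cR Set.Ico_subset_Icc_self ?_
    rw [closure_Ico (by norm_num)]
  have := eq (by simp : (1:ℝ) ∈ Set.Icc (0:ℝ) 1)
  simpa [hG, hF] using this
end

/-- join of two graphs by an edge -/
def jn {A B : Type} (G1 : SimpleGraph A) (G2 : SimpleGraph B) (a : A) (b : B) : SimpleGraph (A ⊕ B) where
  Adj
    | Sum.inl u, Sum.inl v => G1.Adj u v
    | Sum.inr u, Sum.inr v => G2.Adj u v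
    | Sum.inl u, Sum.inr v => u = a ∧ v = b
    | Sum.inr v, Sum.inl u => u = a ∧ v = b
  symm.symm
    | Sum.inl u, Sum.inl v => G1.adj_symm
    | Sum.inr u, Sum.inr v => G2.adj_symm
    | Sum.inl _, Sum.inr _ | Sum.inr _, Sum.inl _ => id
  loopless := ⟨by rintro (u | u) <;> simp⟩

section
variable {A B : Type} (G1 : SimpleGraph A) (G2 : SimpleGraph B) (a : A) (b : B)

@[simp] lemma jn_ll (u v : A) : (jn G1 G2 a b).Adj (.inl u) (.inl v) ↔ G1.Adj u v := Iff.rfl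
@[simp] lemma jn_rr (u v : B) : (jn G1 G2 a b).Adj (.inr u) (.inr v) ↔ G2.Adj u v := Iff.rfl
@[simp] lemma jn_lr (u : A) (v : B) : (jn G1 G2 a b).Adj (.inl u) (.inr v) ↔ (u = a ∧ v = b) := Iff.rfl
@[simp] lemma jn_rl (u : A) (v : B) : (jn G1 G2 a b).Adj (.inr v) (.inl u) ↔ (u = a ∧ v = b) := Iff.rfl

lemma jn_edgeSet : (jn G1 G2 a b).edgeSet =
    insert s(Sum.inl a, Sum.inr b) ((Sym2.map Sum.inl '' G1.edgeSet) ∪ (Sym2.map Sum.inr '' G2.edgeSet)) := by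
  ext e
  induction e with | h x y
  simp only [SimpleGraph.mem_edgeSet, Set.mem_insert_iff, Set.mem_union, Set.mem_image, Sym2.exists,
    Sym2.map_mk, Sym2.eq_iff]
  rcases x with x | x <;> rcases y with y | y <;> simp
  · constructor
    · intro h; exact ⟨x, y, h, by simp⟩
    · rintro ⟨u, v, h, ⟨rfl, rfl⟩ | ⟨rfl, rfl⟩⟩
      exacts [h, h.symm]
  · tauto
  · constructor
    · intro h; exact ⟨x, y, h, by simp⟩
    · rintro ⟨u, v, h, ⟨rfl, rfl⟩ | ⟨rfl, rfl⟩⟩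
      exacts [h, h.symm]

lemma jn_disj1 : s(Sum.inl a, Sum.inr b) ∉ ((Sym2.map Sum.inl '' G1.edgeSet) ∪ (Sym2.map Sum.inr '' G2.edgeSet)) := by
  simp [Sym2.exists]

lemma jn_disj2 : Disjoint (Sym2.map (Sum.inl : A → A ⊕ B) '' G1.edgeSet) (Sym2.map Sum.inr '' G2.edgeSet) := by
  rw [Set.disjoint_left]
  rintro _ ⟨e, _, rfl⟩ ⟨f, _, h⟩
  induction e with | h x y
  induction f with | h x y
  simp at h

lemma jn_card [Finite A] [Finite B] : Nat.card (jn G1 G2 a b).edgeSet =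
    Nat.card G1.edgeSet + Nat.card G2.edgeSet + 1 := by
  simp only [Nat.card_coe_set_eq]
  rw [jn_edgeSet, Set.ncard_insert_of_notMem (jn_disj1 G1 G2 a b) (Set.toFinite _),
    Set.ncard_union_eq (jn_disj2 G1 G2) (Set.toFinite _) (Set.toFinite _),
    Set.ncard_image_of_injective _ (Sym2.map.injective Sum.inl_injective),
    Set.ncard_image_of_injective _ (Sym2.map.injective Sum.inr_injective)]

lemma reach_map {V W : Type*} {G : SimpleGraph V} {H : SimpleGraph W} (f : V → W)
    (hf : ∀ x y, G.Adj x y → H.Reachable (f x) (f y)) {x y : V} (h : G.Reachable x y) :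
    H.Reachable (f x) (f y) := by
  obtain ⟨p⟩ := h
  induction p with
  | nil => rfl
  | cons h p ih => exact (hf _ _ h).trans ih

lemma jn_conn : (jn G1 G2 a b).Connected ↔ G1.Connected ∧ G2.Connected := by
  have : Nonempty A := ⟨a⟩
  have : Nonempty B := ⟨b⟩
  constructor
  · intro h
    constructor
    · refine ⟨fun x y => ?_⟩
      refine reach_map (G := jn G1 G2 a b) (Sum.elim id fun _ => a) ?_ (h.preconnected (.inl x) (.inl y))
      rintro (x | x) (y | y) <;> simp
      · exact fun h => h.reachable
      · rintro rfl _; rfl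
      · rintro rfl _; rfl
    · refine ⟨fun x y => ?_⟩
      refine reach_map (G := jn G1 G2 a b) (Sum.elim (fun _ => b) id) ?_ (h.preconnected (.inr x) (.inr y))
      rintro (x | x) (y | y) <;> simp
      · rintro _ rfl; rfl
      · rintro _ rfl; rfl
      · exact fun h => h.reachable
  · rintro ⟨h1, h2⟩
    have hab : (jn G1 G2 a b).Reachable (.inl a) (.inr b) := SimpleGraph.Adj.reachable (by simp)
    have : ∀ z, (jn G1 G2 a b).Reachable z (.inl a) := by
      rintro (x | x)
      · exact reach_map (G := G1) Sum.inl (fun x y h => SimpleGraph.Adj.reachable (by simpa)) (h1.preconnected x a)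
      · exact (reach_map (G := G2) Sum.inr (fun x y h => SimpleGraph.Adj.reachable (by simpa)) (h2.preconnected x b)).trans hab.symm
    exact ⟨fun x y => (this x).trans (this y).symm⟩

lemma jn_tree [Finite A] [Finite B] : (jn G1 G2 a b).IsTree ↔ G1.IsTree ∧ G2.IsTree := by
  simp only [SimpleGraph.isTree_iff_connected_and_card, jn_conn, jn_card, Nat.card_sum]
  constructor
  · rintro ⟨⟨h1, h2⟩, h⟩
    have := h1.card_vert_le_card_edgeSet_add_one
    have := h2.card_vert_le_card_edgeSet_add_one
    exact ⟨⟨h1, by omega⟩, h2, by omega⟩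
  · rintro ⟨⟨h1, h2⟩, h3, h4⟩
    exact ⟨⟨h1, h3⟩, by omega⟩
end

/-- weight of a graph -/
def gw {S : Type*} (K : Sym2 S → ℝ) {V : Type} (x : V → S) (G : SimpleGraph V) : ℝ :=
  ∏ᶠ e ∈ G.edgeSet, K (e.map x)

/-- total tree weight -/
def TT {S : Type*} (K : Sym2 S → ℝ) (V : Type) [Fintype V] (x : V → S) : ℝ :=
  ∑ G : SimpleGraph V with G.IsTree, gw K x G

lemma gw_jn {S : Type*} (K : Sym2 S → ℝ) {A B : Type} [Finite A] [Finite B]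
    (G1 : SimpleGraph A) (G2 : SimpleGraph B) (a : A) (b : B) (x : A ⊕ B → S) :
    gw K x (jn G1 G2 a b) = K s(x (.inl a), x (.inr b)) * (gw K (x ∘ Sum.inl) G1 * gw K (x ∘ Sum.inr) G2) := by
  unfold gw
  rw [jn_edgeSet, finprod_mem_insert _ (jn_disj1 G1 G2 a b) (Set.toFinite _),
    finprod_mem_union (jn_disj2 G1 G2) (Set.toFinite _) (Set.toFinite _),
    finprod_mem_image (Sym2.map.injective Sum.inl_injective).injOn,
    finprod_mem_image (Sym2.map.injective Sum.inr_injective).injOn]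
  simp [Sym2.map_map]

/-- only crossing edge -/
def Cross {V : Type} (G : SimpleGraph V) (A : Set V) (a v : V) : Prop :=
  ∀ x ∈ A, ∀ y ∉ A, G.Adj x y ↔ (x = a ∧ y = v)

lemma TT_jn {S : Type*} (K : Sym2 S → ℝ) {A B : Type} [Fintype A] [Fintype B]
    (a : A) (b : B) (x : A ⊕ B → S) :
    ∑ G : SimpleGraph (A ⊕ B) with G.IsTree ∧ ∀ u v, G.Adj (.inl u) (.inr v) ↔ (u = a ∧ v = b), gw K x G
     = K s(x (.inl a), x (.inr b)) * (TT K A (x ∘ Sum.inl) * TT K B (x ∘ Sum.inr)) := by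
  unfold TT
  rw [Finset.sum_mul_sum, ← Finset.sum_product', Finset.mul_sum]
  symm
  refine Finset.sum_bij' (fun p _ => jn p.1 p.2 a b) (fun G _ => (G.comap Sum.inl, G.comap Sum.inr)) ?_ ?_ ?_ ?_ ?_
  · rintro ⟨G1, G2⟩ h
    simp only [Finset.mem_product, Finset.mem_filter, Finset.mem_univ, true_and] at h
    simp [jn_tree, h]
  · intro G h
    simp only [Finset.mem_filter, Finset.mem_univ, true_and, Finset.mem_product] at h ⊢
    have : G = jn (G.comap Sum.inl) (G.comap Sum.inr) a b := by
      ext u v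
      rcases u with u | u <;> rcases v with v | v <;> simp [h.2]
      rw [SimpleGraph.adj_comm, h.2]
    rw [this, jn_tree] at h
    exact h.1
  · rintro ⟨G1, G2⟩ h
    ext u v <;> simp
  · intro G h
    simp only [Finset.mem_filter, Finset.mem_univ, true_and] at h
    ext u v
    rcases u with u | u <;> rcases v with v | v <;> simp [h.2]
    rw [SimpleGraph.adj_comm, h.2]
  · rintro ⟨G1, G2⟩ h
    rw [gw_jn]

lemma gw_equiv {S : Type*} (K : Sym2 S → ℝ) {V W : Type} (φ : V ≃ W) (x : W → S) (G : SimpleGraph W) :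
    gw K (x ∘ φ) (G.comap φ) = gw K x G := by
  unfold gw
  have : G.edgeSet = Sym2.map φ '' (G.comap φ).edgeSet := by
    ext e
    constructor
    · intro h
      refine ⟨e.map φ.symm, ?_, by simp [Sym2.map_map]⟩
      induction e with | h x y
      simpa using h
    · rintro ⟨e, h, rfl⟩
      induction e with | h x y
      simpa using h
  rw [this, finprod_mem_image (Sym2.map.injective φ.injective).injOn]
  simp [Sym2.map_map]

lemma tree_equiv {V W : Type} (φ : V ≃ W) (G : SimpleGraph W) :
    (G.comap φ).IsTree ↔ G.IsTree := 
  (SimpleGraph.Iso.comap φ G).isTree_iff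

lemma TT_equiv {S : Type*} (K : Sym2 S → ℝ) {V W : Type} [Fintype V] [Fintype W] (φ : V ≃ W) (x : W → S) :
    TT K V (x ∘ φ) = TT K W x := by
  unfold TT
  symm
  refine Finset.sum_equiv φ.symm.simpleGraph ?_ ?_
  · intro G
    simpa using (tree_equiv φ G).symm
  · intro G _
    exact (gw_equiv K φ x G).symm

lemma TT_cross {S : Type*} (K : Sym2 S → ℝ) {V : Type} [Fintype V] (A : Finset V) (a v : V)
    (ha : a ∈ A) (hv : v ∉ A) (x : V → S) :
    ∑ G : SimpleGraph V with G.IsTree ∧ Cross G (A : Set V) a v, gw K x G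
     = K s(x a, x v) * (TT K {i // i ∈ A} (fun i => x i) * TT K {i // ¬ i ∈ A} (fun i => x i)) := by
  have := TT_jn K (A := {i // i ∈ A}) (B := {i // ¬ i ∈ A}) ⟨a, ha⟩ ⟨v, hv⟩ (x ∘ Equiv.sumCompl (fun i => i ∈ A))
  simp only [Function.comp_apply, Equiv.sumCompl_apply_inl, Equiv.sumCompl_apply_inr] at this
  refine Eq.trans ?_ this
  refine Finset.sum_equiv (Equiv.sumCompl (fun i => i ∈ A)).symm.simpleGraph ?_ ?_
  · intro G
    simp only [Finset.mem_filter, Finset.mem_univ, true_and]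
    refine and_congr (tree_equiv (Equiv.sumCompl (fun i => i ∈ A)) G).symm ?_
    simp [Cross, Equiv.simpleGraph]
  · intro G _
    exact (gw_equiv K (Equiv.sumCompl (fun i => i ∈ A)) x G).symm

lemma cross_iff {V : Type} (G : SimpleGraph V) (hG : G.IsTree) (u v : V) (huv : u ≠ v) :
    ∃! p : Set V × V, (u ∈ p.1 ∧ v ∉ p.1) ∧ p.2 ∈ p.1 ∧ Cross G p.1 p.2 v := by
  obtain ⟨p, hp, hpu⟩ := hG.existsUnique_path v u
  cases p with
  | nil => exact absurd rfl huv
  | @cons _ a _ hva q =>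
  have hq := (SimpleGraph.Walk.cons_isPath_iff _ _).1 hp
  set H := G.deleteEdges {s(v, a)} with hH
  have hbr : ¬ H.Reachable v a := by
    have := (SimpleGraph.isAcyclic_iff_forall_adj_isBridge.1 hG.isAcyclic) hva
    exact SimpleGraph.isBridge_iff.1 this
  have hHadj : ∀ x y, H.Adj x y ↔ G.Adj x y ∧ s(x, y) ≠ s(v, a) := by
    intro x y; simp [hH, SimpleGraph.deleteEdges_adj]
  have hau : H.Reachable a u := by
    refine SimpleGraph.reachable_deleteEdges_iff_exists_walk.2 ⟨q, fun h => hq.2 ?_⟩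
    exact SimpleGraph.Walk.fst_mem_support_of_mem_edges _ h
  have hor : ∀ x, H.Reachable a x ∨ H.Reachable v x := by
    have aux : ∀ (x z : V), G.Walk x z → z = a → (H.Reachable a x ∨ H.Reachable v x) := by
      intro x z w
      induction w with
      | nil => rintro rfl; exact Or.inl (by rfl)
      | @cons x y _ h w ih =>
        intro hz
        by_cases e : s(x, y) = s(v, a)
        · rcases Sym2.eq_iff.1 e with ⟨h1, h2⟩ | ⟨h1, h2⟩
          · exact Or.inr (by rw [h1])
          · exact Or.inl (by rw [h1])
        · have := (((hHadj x y).2 ⟨h, e⟩).symm).reachable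
          exact (ih hz).imp (fun h => h.trans this) (fun h => h.trans this)
    intro x
    obtain ⟨w⟩ := hG.connected.preconnected x a
    exact aux x a w rfl
  refine ⟨({x | H.Reachable a x}, a), ⟨⟨hau, fun h => hbr h.symm⟩, SimpleGraph.Reachable.refl _, ?_⟩, ?_⟩
  · intro x hx y hy
    constructor
    · intro h
      by_contra hne
      refine hy (SimpleGraph.Reachable.trans hx (((hHadj x y).2 ⟨h, fun e => ?_⟩).reachable))
      rcases Sym2.eq_iff.1 e with ⟨rfl, rfl⟩ | ⟨rfl, rfl⟩
      · exact hbr (SimpleGraph.Reachable.symm hx)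
      · exact hne ⟨rfl, rfl⟩
    · rintro ⟨rfl, rfl⟩; exact hva.symm
  · rintro ⟨B, b⟩ ⟨⟨huB, hvB⟩, hbB, hc⟩
    simp only at huB hvB hbB hc
    -- q stays in B
    have hqB : ∀ (x z : V) (w : G.Walk x z), z ∈ B → v ∉ w.support → x ∈ B := by
      intro x z w
      induction w with
      | nil => intro h _; exact h
      | @cons x y _ h w ih =>
        intro hz hs
        simp only [SimpleGraph.Walk.support_cons, List.mem_cons, not_or] at hs
        have hy : y ∈ B := ih hz hs.2
        by_contra hx
        exact hs.1 ((hc y hy x hx).1 h.symm).2.symm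
    have haB : a ∈ B := hqB a u q huB hq.2
    have hab : a = b := ((hc a haB v hvB).1 hva.symm).1
    subst hab
    have hcl : ∀ x y, H.Adj x y → (x ∈ B ↔ y ∈ B) := by
      intro x y h
      obtain ⟨h1, h2⟩ := (hHadj x y).1 h
      constructor
      · intro hx; by_contra hy
        obtain ⟨rfl, rfl⟩ := (hc x hx y hy).1 h1
        exact h2 Sym2.eq_swap
      · intro hy; by_contra hx
        obtain ⟨rfl, rfl⟩ := (hc y hy x hx).1 h1.symm
        exact h2 rfl
    have hcl' : ∀ x y, H.Reachable x y → (x ∈ B ↔ y ∈ B) := by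
      rintro x y ⟨w⟩
      induction w with
      | nil => rfl
      | cons h w ih => exact (hcl _ _ h).trans ih
    refine Prod.ext (Set.ext fun x => ?_) rfl
    simp only [Set.mem_ofPred_eq]
    constructor
    · intro hx
      exact (hor x).resolve_right fun h => hvB ((hcl' _ _ h).2 hx)
    · intro h; exact (hcl' _ _ h).1 haB

lemma TT_rec {S : Type*} (K : Sym2 S → ℝ) {V : Type} [Fintype V] (u v : V) (huv : u ≠ v) (x : V → S) :
    TT K V x = ∑ A : Finset V with u ∈ A ∧ v ∉ A, ∑ a ∈ A,
      K s(x a, x v) * (TT K {i // i ∈ A} (fun i => x i) * TT K {i // ¬ i ∈ A} (fun i => x i)) := by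
  have h1 : ∀ A ∈ (Finset.univ.filter fun A : Finset V => u ∈ A ∧ v ∉ A), ∀ a ∈ A,
      K s(x a, x v) * (TT K {i // i ∈ A} (fun i => x i) * TT K {i // ¬ i ∈ A} (fun i => x i)) =
      ∑ G : SimpleGraph V with G.IsTree, if Cross G (A : Set V) a v then gw K x G else 0 := by
    intro A hA a ha
    rw [← TT_cross K A a v ha (by simpa using (Finset.mem_filter.1 hA).2.2), ← Finset.sum_filter, Finset.filter_filter]
  rw [Finset.sum_congr rfl fun A hA => Finset.sum_congr rfl fun a ha => h1 A hA a ha]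
  rw [Finset.sum_congr rfl fun A hA => Finset.sum_comm, Finset.sum_comm]
  unfold TT
  refine Finset.sum_congr rfl fun G hG => ?_
  obtain ⟨⟨B, b⟩, ⟨⟨h1, h2⟩, h3, h4⟩, hun⟩ := cross_iff G (Finset.mem_filter.1 hG).2 u v huv
  simp only at h1 h2 h3 h4
  rw [Finset.sum_eq_single B.toFinset, Finset.sum_eq_single b]
  · simp [h4]
  · intro a ha hab
    refine if_neg fun hc => hab ?_
    have := hun (B, a) ⟨⟨h1, h2⟩, by simpa using ha, by simpa using hc⟩
    exact (Prod.ext_iff.1 this).2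
  · intro h; simp [h3] at h
  · intro A hA hAB
    refine Finset.sum_eq_zero fun a ha => if_neg fun hc => hAB ?_
    have hA' := (Finset.mem_filter.1 hA).2
    have := hun (A, a) ⟨by simpa using hA', by simpa using ha, hc⟩
    have := (Prod.ext_iff.1 this).1
    simp only at this
    ext y; simp [← this]
  · intro h; simp [h1, h2] at h

/-- rooted coloured tree weight -/
def RR {S : Type*} [Fintype S] (K : Sym2 S → ℝ) (θ : S → ℝ) (V : Type) [Fintype V] (v : V) (r : S) : ℝ :=
  ∑ x : V → S, if x v = r then TT K V x * ∏ i, θ (x i) else 0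

lemma RR_equiv {S : Type*} [Fintype S] (K : Sym2 S → ℝ) (θ : S → ℝ) {V W : Type} [Fintype V] [Fintype W]
    (φ : V ≃ W) (v : V) (r : S) : RR K θ V v r = RR K θ W (φ v) r := by
  unfold RR
  symm
  refine Fintype.sum_equiv (Equiv.arrowCongr φ.symm (Equiv.refl S)) _ _ fun x => ?_
  have : (Equiv.arrowCongr φ.symm (Equiv.refl S)) x = x ∘ φ := by ext; simp
  rw [this, TT_equiv]
  simp only [Function.comp_apply]
  rw [Equiv.prod_comp φ (fun i => θ (x i))]

lemma RR_prod {S : Type*} [Fintype S] (K : Sym2 S → ℝ) (θ : S → ℝ) {A B : Type} [Fintype A] [Fintype B]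
    (a : A) (b : B) (r : S) [inst1 : Fintype (A → S)] [inst2 : Fintype (B → S)] :
    (∑ s, K s(s, r) * RR K θ A a s) * RR K θ B b r =
    ∑ x : A → S, ∑ y : B → S, if y b = r then
      K s(x a, r) * (TT K A x * TT K B y) * ((∏ i, θ (x i)) * ∏ i, θ (y i)) else 0 := by
  have : ∑ s, K s(s, r) * RR K θ A a s = ∑ x : A → S, K s(x a, r) * (TT K A x * ∏ i, θ (x i)) := by
    simp only [RR, Finset.mul_sum]
    rw [Finset.sum_comm]
    refine Finset.sum_congr (by congr!) fun x _ => ?_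
    rw [Finset.sum_eq_single (x a)]
    · simp
    · intro s _ hs; simp [Ne.symm hs]
    · simp
  rw [this, RR, Finset.sum_mul_sum]
  refine Finset.sum_congr rfl fun x _ => Finset.sum_congr (by congr!) fun y _ => ?_
  split_ifs
  · ring
  · simp

lemma RR_rec {S : Type*} [Fintype S] (K : Sym2 S → ℝ) (θ : S → ℝ) {V : Type} [Fintype V]
    (u v : V) (huv : u ≠ v) (r : S) :
    RR K θ V v r = ∑ A : Finset V with u ∈ A ∧ v ∉ A, ∑ a : {i // i ∈ A}, 
      if hv : ¬ v ∈ A then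
        (∑ s, K s(s, r) * RR K θ {i // i ∈ A} a s) * RR K θ {i // ¬ i ∈ A} ⟨v, hv⟩ r else 0 := by
  have e : ∀ x : V → S, (if x v = r then TT K V x * ∏ i, θ (x i) else 0) = 
      ∑ A : Finset V with u ∈ A ∧ v ∉ A, ∑ a : {i // i ∈ A}, if x v = r then 
        K s(x a, x v) * (TT K {i // i ∈ A} (fun i => x i) * TT K {i // ¬ i ∈ A} (fun i => x i)) * ∏ i, θ (x i) else 0 := by
    intro x
    split_ifs
    · rw [TT_rec K u v huv, Finset.sum_mul]
      refine Finset.sum_congr rfl fun A _ => ?_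
      rw [Finset.sum_mul, ← Finset.sum_coe_sort]
    · simp
  rw [RR, Finset.sum_congr rfl fun x _ => e x, Finset.sum_comm]
  refine Finset.sum_congr rfl fun A hA => ?_
  rw [Finset.sum_comm]
  refine Finset.sum_congr rfl fun a _ => ?_
  have hv := (Finset.mem_filter.1 hA).2.2
  rw [dif_pos hv]
  rw [RR_prod, ← Fintype.sum_prod_type']
  refine Fintype.sum_equiv (Equiv.piEquivPiSubtypeProd (fun i => i ∈ A) (fun _ => S)) _ _ fun x => ?_
  simp only [Equiv.piEquivPiSubtypeProd_apply]
  split_ifs with h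
  · rw [← Fintype.prod_subtype_mul_prod_subtype (fun i => i ∈ A) (fun i => θ (x i)), h]
    congr!
  · rfl

lemma RR_fin {S : Type*} [Fintype S] (K : Sym2 S → ℝ) (θ : S → ℝ) {V : Type} [Fintype V]
    (v : V) (r : S) (n : ℕ) (hn : Nat.card V = n + 1) : RR K θ V v r = RR K θ (Fin (n+1)) 0 r := by
  have φ : V ≃ Fin (n+1) := Finite.equivFinOfCardEq hn
  rw [RR_equiv K θ (φ.trans (Equiv.swap (φ v) 0))]
  simp

lemma RR_fin' {S : Type*} [Fintype S] (K : Sym2 S → ℝ) (θ : S → ℝ) {V : Type} (i : Fintype V)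
    (v : V) (r : S) (n : ℕ) (hn : Nat.card V = n + 1) : RR K θ V v r = RR K θ (Fin (n+1)) 0 r :=
  RR_fin K θ v r n hn

/-- coefficient -/
def rho {S : Type*} [Fintype S] (K : Sym2 S → ℝ) (θ : S → ℝ) (n : ℕ) (r : S) : ℝ := RR K θ (Fin (n+1)) 0 r

lemma rho_rec {S : Type*} [Fintype S] (K : Sym2 S → ℝ) (θ : S → ℝ) (n : ℕ) (r : S) :
    rho K θ (n+1) r = ∑ m ∈ Finset.range (n+1), (n.choose m : ℝ) * 
      (((m:ℝ)+1) * (∑ s, K s(s, r) * rho K θ m s) * rho K θ (n-m) r) := by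
  have h10 : (1 : Fin (n+2)) ≠ 0 := by simp
  rw [rho, RR_rec K θ 1 0 h10]
  set h : ℕ → ℝ := fun m => ((m:ℝ)+1) * (∑ s, K s(s, r) * rho K θ m s) * rho K θ (n-m) r with hh
  set U : Finset (Fin (n+2)) := Finset.univ.erase 0 |>.erase 1 with hU
  have hUc : U.card = n := by simp [hU, Finset.card_erase_of_mem]
  have h1U : (1 : Fin (n+2)) ∉ U := by simp [hU]
  have h0U : (0 : Fin (n+2)) ∉ U := by simp [hU]
  have e := Finset.sum_powerset_apply_card h (x := U)
  rw [hUc] at e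
  simp only [nsmul_eq_mul] at e
  rw [← e]
  symm
  refine Finset.sum_bij' (fun B _ => insert 1 B) (fun A _ => A.erase 1) ?_ ?_ ?_ ?_ ?_
  · intro B hB
    have hB := Finset.mem_powerset.1 hB
    simp only [Finset.mem_filter, Finset.mem_univ, true_and, Finset.mem_insert, not_or]
    exact ⟨by simp, h10.symm, fun h => h0U (hB h)⟩
  · intro A hA
    simp only [Finset.mem_filter, Finset.mem_univ, true_and] at hA
    rw [Finset.mem_powerset]
    intro y hy
    simp only [Finset.mem_erase, hU, Finset.mem_univ, and_true] at hy ⊢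
    exact ⟨hy.1, fun h => hA.2 (h ▸ hy.2)⟩
  · intro B hB
    have hB := Finset.mem_powerset.1 hB
    exact Finset.erase_insert fun h => h1U (hB h)
  · intro A hA
    simp only [Finset.mem_filter, Finset.mem_univ, true_and] at hA
    exact Finset.insert_erase hA.1
  · intro B hB
    have hB := Finset.mem_powerset.1 hB
    have hv : ¬ (0 : Fin (n+2)) ∈ insert 1 B := by
      simp only [Finset.mem_insert, not_or]
      exact ⟨h10.symm, fun h => h0U (hB h)⟩
    have hc : (insert 1 B).card = B.card + 1 := Finset.card_insert_of_notMem fun h => h1U (hB h)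
    have hBn : B.card ≤ n := (Finset.card_le_card hB).trans hUc.le
    have c1 : Nat.card {i // i ∈ insert 1 B} = B.card + 1 := by
      rw [← hc]; exact Nat.card_eq_fintype_card.trans (Fintype.card_coe _)
    have c2 : Nat.card {i // ¬ i ∈ insert 1 B} = (n - B.card) + 1 := by
      have h3 : Nat.card {i // ¬ i ∈ insert 1 B} = ((insert 1 B)ᶜ).card := by
        rw [← Fintype.card_coe, ← Nat.card_eq_fintype_card]
        exact Nat.card_congr (Equiv.subtypeEquivRight fun i => by simp)
      rw [h3, Finset.card_compl, hc, Fintype.card_fin]; omega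
    simp only [dif_pos hv]
    rw [Finset.sum_congr rfl (g := fun _ => (∑ s, K s(s, r) * rho K θ B.card s) * rho K θ (n - B.card) r)]
    · rw [Finset.sum_const, Finset.card_univ, ← Nat.card_eq_fintype_card, c1, nsmul_eq_mul]
      simp only [hh]
      push_cast
      ring
    · intro a _
      congr 1
      · exact Finset.sum_congr rfl fun s _ => congrArg _ (RR_fin K θ a s _ c1)
      · exact RR_fin' K θ _ _ r _ c2

lemma rho_zero {S : Type*} [Fintype S] (K : Sym2 S → ℝ) (θ : S → ℝ) (r : S) :
    rho K θ 0 r = θ r := by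
  have hss : Subsingleton (Fin (0+1)) := inferInstanceAs (Subsingleton (Fin 1))
  have hT : ∀ x : Fin (0+1) → S, TT K (Fin (0+1)) x = 1 := by
    intro x
    have : ∀ G : SimpleGraph (Fin (0+1)), G = ⊥ := fun G => by
      ext x y; simp [Subsingleton.elim x y]
    unfold TT
    rw [Finset.sum_eq_single ⊥]
    · simp [gw]
    · intro G _ h; exact absurd (this G) h
    · intro h
      exfalso; apply h
      simp only [Finset.mem_filter, Finset.mem_univ, true_and]
      exact SimpleGraph.IsTree.of_subsingleton
  unfold rho RR
  simp only [hT, one_mul]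
  rw [Finset.sum_eq_single (fun _ => r)]
  · simp
  · intro x _ hx
    refine if_neg fun h => hx ?_
    ext i; rw [← h]; congr 1; exact Subsingleton.elim _ _
  · simp

lemma c_rec {S : Type*} [Fintype S] (K : Sym2 S → ℝ) (θ : S → ℝ) (n : ℕ) (r : S) :
    ((n:ℝ) + 1) * (rho K θ (n+1) r / ((n+1).factorial : ℝ)) =
      ∑ p ∈ Finset.HasAntidiagonal.antidiagonal n, (rho K θ p.1 r / (p.1.factorial : ℝ)) *
        (((p.2:ℝ) + 1) * ∑ s, K s(r, s) * (rho K θ p.2 s / (p.2.factorial : ℝ))) := by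
  rw [rho_rec, Finset.Nat.antidiagonal_eq_map', Finset.sum_map]
  dsimp only [Function.Embedding.coeFn_mk, DFunLike.coe]
  rw [Finset.sum_div, Finset.mul_sum]
  refine Finset.sum_congr rfl fun m hm => ?_
  have hm : m ≤ n := Nat.lt_succ_iff.1 (Finset.mem_range.1 hm)
  have e : ∑ s, K s(r, s) * (rho K θ m s / (m.factorial : ℝ)) = (∑ s, K s(s, r) * rho K θ m s) / (m.factorial : ℝ) := by
    rw [Finset.sum_div]
    exact Finset.sum_congr rfl fun s _ => by rw [Sym2.eq_swap]; ring
  rw [e, Nat.cast_choose ℝ hm, Nat.factorial_succ]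
  push_cast
  have := Nat.cast_ne_zero (R := ℝ).2 (Nat.factorial_ne_zero n)
  have := Nat.cast_ne_zero (R := ℝ).2 (Nat.factorial_ne_zero m)
  have := Nat.cast_ne_zero (R := ℝ).2 (Nat.factorial_ne_zero (n-m))
  have : (n:ℝ)+1 ≠ 0 := by positivity
  field_simp

lemma rho_nonneg {S : Type*} [Fintype S] (K : Sym2 S → ℝ) (hK : ∀ e, 0 ≤ K e) (θ : S → ℝ) (hθ : ∀ s, 0 ≤ θ s) (n : ℕ) (r : S) :
    0 ≤ rho K θ n r := by
  unfold rho RR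
  refine Finset.sum_nonneg fun x _ => ?_
  split_ifs
  · refine mul_nonneg (Finset.sum_nonneg fun G _ => ?_) (Finset.prod_nonneg fun i _ => hθ _)
    exact finprod_cond_nonneg fun e _ => hK _
  · rfl

lemma edges_graphOf {n : ℕ} (E : Finset (Fin n × Fin n)) (hE : E ⊆ upperPairs n) :
    (graphOf E).edgeSet = (fun q : Fin n × Fin n => s(q.1, q.2)) '' (E : Set (Fin n × Fin n)) := by
  ext e
  induction e with | h x y
  simp only [graphOf, SimpleGraph.mem_edgeSet, SimpleGraph.fromRel_adj, Set.mem_image, Finset.mem_coe, Prod.exists, Sym2.eq_iff]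
  constructor
  · rintro ⟨_, h | h⟩
    · exact ⟨x, y, h, by simp⟩
    · exact ⟨y, x, h, by simp⟩
  · rintro ⟨a, b, h, ⟨rfl, rfl⟩ | ⟨rfl, rfl⟩⟩
    · have := (Finset.mem_filter.1 (hE h)).2
      exact ⟨this.ne, Or.inl h⟩
    · have := (Finset.mem_filter.1 (hE h)).2
      exact ⟨this.ne', Or.inr h⟩

lemma upper_inj {n : ℕ} (E : Finset (Fin n × Fin n)) (hE : E ⊆ upperPairs n) :
    Set.InjOn (fun q : Fin n × Fin n => s(q.1, q.2)) (E : Set (Fin n × Fin n)) := by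
  rintro ⟨a, b⟩ h ⟨c, d⟩ h' e
  have h1 := (Finset.mem_filter.1 (hE h)).2
  have h2 := (Finset.mem_filter.1 (hE h')).2
  simp only at h1 h2
  rcases Sym2.eq_iff.1 e with ⟨rfl, rfl⟩ | ⟨rfl, rfl⟩
  · rfl
  · exact absurd h1 h2.asymm

lemma treeWeight_eq {S : Type*} (κ : S → S → ℝ) (hκsym : ∀ r s, κ r s = κ s r) (n : ℕ) (x : Fin n → S) :
    treeWeight n x κ = TT (Sym2.lift ⟨κ, hκsym⟩) (Fin n) x := by
  unfold treeWeight TT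
  refine Finset.sum_bij' (fun E _ => graphOf E)
    (fun G _ => Finset.univ.filter fun q : Fin n × Fin n => q.1 < q.2 ∧ G.Adj q.1 q.2) ?_ ?_ ?_ ?_ ?_
  · intro E hE
    simp only [Finset.mem_filter, Finset.mem_powerset, Finset.mem_univ, true_and] at hE ⊢
    rw [SimpleGraph.isTree_iff_connected_and_card, edges_graphOf E hE.1, Nat.card_coe_set_eq,
      Set.ncard_image_of_injOn (upper_inj E hE.1), Set.ncard_coe_finset, Nat.card_fin]
    exact hE.2
  · intro G hG
    set E := Finset.univ.filter fun q : Fin n × Fin n => q.1 < q.2 ∧ G.Adj q.1 q.2 with hEd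
    have hE : E ⊆ upperPairs n := by
      intro q hq
      simp only [hEd, upperPairs, Finset.mem_filter, Finset.mem_univ, true_and] at hq ⊢
      exact hq.1
    have hGE : graphOf E = G := by
      ext a b
      simp only [graphOf, SimpleGraph.fromRel_adj, hEd, Finset.mem_filter, Finset.mem_univ, true_and]
      constructor
      · rintro ⟨_, h | h⟩
        exacts [h.2, h.2.symm]
      · intro h
        refine ⟨h.ne, ?_⟩
        rcases lt_or_gt_of_ne h.ne with h' | h'
        exacts [Or.inl ⟨h', h⟩, Or.inr ⟨h', h.symm⟩]
    simp only [Finset.mem_filter, Finset.mem_powerset, Finset.mem_univ, true_and] at hG ⊢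
    refine ⟨hE, ?_⟩
    rw [← hGE, SimpleGraph.isTree_iff_connected_and_card, edges_graphOf E hE, Nat.card_coe_set_eq,
      Set.ncard_image_of_injOn (upper_inj E hE), Set.ncard_coe_finset, Nat.card_fin] at hG
    exact hG
  · intro E hE
    simp only [Finset.mem_filter, Finset.mem_powerset, Finset.mem_univ, true_and] at hE
    ext ⟨a, b⟩
    simp only [graphOf, SimpleGraph.fromRel_adj, Finset.mem_filter, Finset.mem_univ, true_and]
    constructor
    · rintro ⟨h1, _, h | h⟩
      · exact h
      · have h2 := (Finset.mem_filter.1 (hE.1 h)).2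
        exact absurd h1 h2.asymm
    · intro h
      have h2 := (Finset.mem_filter.1 (hE.1 h)).2
      exact ⟨h2, h2.ne, Or.inl h⟩
  · intro G hG
    ext a b
    simp only [graphOf, SimpleGraph.fromRel_adj, Finset.mem_filter, Finset.mem_univ, true_and]
    constructor
    · rintro ⟨_, h | h⟩
      exacts [h.2, h.2.symm]
    · intro h
      refine ⟨h.ne, ?_⟩
      rcases lt_or_gt_of_ne h.ne with h' | h'
      exacts [Or.inl ⟨h', h⟩, Or.inr ⟨h', h.symm⟩]
  · intro E hE
    simp only [Finset.mem_filter, Finset.mem_powerset, Finset.mem_univ, true_and] at hE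
    unfold gw
    rw [edges_graphOf E hE.1, finprod_mem_image (upper_inj E hE.1), finprod_mem_coe_finset]
    rfl

/-- counts -/
def cnt {S : Type*} {n : ℕ} (x : Fin n → S) (s : S) : ℕ := (Finset.univ.filter fun i => x i = s).card

lemma cnt_compat {S : Type*} [Fintype S] (k : S → ℕ) : cnt (compatVec k) = k := by
  ext s
  have h1 : cnt (compatVec k) s = Multiset.count s (Finset.univ.val.map (compatVec k)) := by
    rw [Multiset.count_map, cnt, Finset.card, Finset.filter_val]
    congr 1
    exact Multiset.filter_congr fun i _ => eq_comm
  have h2 : List.ofFn (compatVec k) = compatList k := by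
    apply List.ext_getElem
    · simp [compatList_length]
    · intro i _ _
      simp [compatVec]
  rw [h1, Fin.univ_val_map, h2, compatList, Multiset.coe_toList, Multiset.count_sum']
  simp [Multiset.count_nsmul, Multiset.count_singleton]

lemma cnt_comp {S : Type*} {n : ℕ} (x : Fin n → S) (g : Equiv.Perm (Fin n)) : cnt (x ∘ g) = cnt x := by
  ext s
  unfold cnt
  refine Finset.card_equiv g fun i => by simp

lemma perm_of_cnt {S : Type*} {n : ℕ} (x y : Fin n → S) (h : cnt x = cnt y) :
    ∃ g : Equiv.Perm (Fin n), y ∘ g = x := by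
  have e : ∀ s, Nonempty ({i // x i = s} ≃ {i // y i = s}) := fun s => by
    rw [← Fintype.card_eq, Fintype.card_subtype, Fintype.card_subtype]
    exact congrFun h s
  refine ⟨Equiv.ofFiberEquiv (f := x) (g := y) fun s => (e s).some, ?_⟩
  ext i
  exact Equiv.ofFiberEquiv_map _ i

lemma sum_cnt {S : Type*} [Fintype S] {n : ℕ} (h : (Fin n → S) → ℝ)
    (hh : ∀ x (g : Equiv.Perm (Fin n)), h (x ∘ g) = h x) (x0 : Fin n → S) :
    ((∏ s, (cnt x0 s).factorial : ℕ) : ℝ) * ∑ x : Fin n → S with cnt x = cnt x0, h x = (n.factorial : ℝ) * h x0 := by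
  have e1 : ∑ g : Equiv.Perm (Fin n), h (x0 ∘ g) = (n.factorial : ℝ) * h x0 := by
    simp [hh, Fintype.card_perm]
  rw [← e1, ← Finset.sum_fiberwise_of_maps_to (t := Finset.univ.filter fun x : Fin n → S => cnt x = cnt x0) (g := fun g : Equiv.Perm (Fin n) => x0 ∘ g) (fun g _ => by simp [cnt_comp]), Finset.mul_sum]
  refine Finset.sum_congr rfl fun x hx => ?_
  obtain ⟨g0, hg0⟩ := perm_of_cnt x x0 (Finset.mem_filter.1 hx).2
  have : ∑ g ∈ Finset.univ.filter (fun g : Equiv.Perm (Fin n) => x0 ∘ (g : Fin n → Fin n) = x), h (x0 ∘ (g : Fin n → Fin n)) =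
      ∑ g ∈ Finset.univ.filter (fun g : Equiv.Perm (Fin n) => x0 ∘ (g : Fin n → Fin n) = x), h x :=
    Finset.sum_congr rfl fun g hg => by rw [(Finset.mem_filter.1 hg).2]
  rw [this, Finset.sum_const, nsmul_eq_mul]
  congr 2
  have st := DomMulAct.stabilizer_card x0
  rw [Fintype.card_subtype] at st
  have : ∏ s, (cnt x0 s).factorial = ∏ i, (Fintype.card {a // x0 a = i}).factorial := 
    Finset.prod_congr rfl fun s _ => by rw [Fintype.card_subtype, cnt]
  rw [this, ← st]
  refine Finset.card_equiv (Equiv.mulRight g0) fun g => ?_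
  simp only [Finset.mem_filter, Finset.mem_univ, true_and, Equiv.coe_mulRight, Equiv.Perm.coe_mul]
  rw [← hg0, ← Function.comp_assoc]
  constructor
  · intro h; rw [h]
  · intro h
    exact g0.surjective.injective_comp_right h

lemma level_sum {S : Type*} [Fintype S] (κ : S → S → ℝ) (hκsym : ∀ r s, κ r s = κ s r) (θ : S → ℝ) (n : ℕ) (r : S) :
    ∑ k ∈ Finset.piAntidiag (Finset.univ : Finset S) n, (tau κ k * (k r : ℝ) *
          ∏ s : S, θ s ^ (k s) / (Nat.factorial (k s) : ℝ))
      = (∑ i : Fin n, RR (Sym2.lift ⟨κ, hκsym⟩) θ (Fin n) i r) / (n.factorial : ℝ) := by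
  set h : (Fin n → S) → ℝ := fun x => TT (Sym2.lift ⟨κ, hκsym⟩) (Fin n) x * (cnt x r : ℝ) * ∏ i, θ (x i) with hh
  have hinv : ∀ x (g : Equiv.Perm (Fin n)), h (x ∘ g) = h x := by
    intro x g
    simp only [hh]
    rw [TT_equiv, cnt_comp]
    congr 1
    exact Equiv.prod_comp g (fun i => θ (x i))
  have e1 : ∑ i : Fin n, RR (Sym2.lift ⟨κ, hκsym⟩) θ (Fin n) i r = ∑ x, h x := by
    unfold RR
    rw [Finset.sum_comm]
    refine Finset.sum_congr (by congr!) fun x _ => ?_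
    rw [← Finset.sum_filter, Finset.sum_const, nsmul_eq_mul]
    simp only [hh, cnt]
    ring
  have hm : ∀ x : Fin n → S, cnt x ∈ Finset.piAntidiag (Finset.univ : Finset S) n := by
    intro x
    simp only [Finset.mem_piAntidiag, Finset.mem_univ, implies_true, and_true]
    have := Finset.card_eq_sum_card_fiberwise (f := x) (s := Finset.univ) (t := Finset.univ) (fun _ _ => by simp)
    rw [Finset.card_univ, Fintype.card_fin] at this
    exact this.symm
  rw [e1, ← Finset.sum_fiberwise_of_maps_to (fun x _ => hm x), Finset.sum_div]
  refine Finset.sum_congr rfl fun k hk => ?_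
  have hk : ∑ s, k s = n := (Finset.mem_piAntidiag.1 hk).1
  subst hk
  have := sum_cnt h hinv (compatVec k)
  rw [cnt_compat] at this
  have hp : ∏ i, θ (compatVec k i) = ∏ s, θ s ^ k s := by
    rw [← Finset.prod_fiberwise_of_maps_to (t := Finset.univ) (g := compatVec k) (fun _ _ => by simp)]
    refine Finset.prod_congr rfl fun s _ => ?_
    rw [Finset.prod_congr rfl (g := fun _ => θ s) fun i hi => by rw [(Finset.mem_filter.1 hi).2], Finset.prod_const]
    congr 1
    exact congrFun (cnt_compat k) s
  have hx : h (compatVec k) = tau κ k * (k r : ℝ) * ∏ s, θ s ^ k s := by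
    simp only [hh]
    rw [cnt_compat, hp, tau, treeWeight_eq κ hκsym]
  rw [hx] at this
  rw [Finset.prod_div_distrib, eq_div_iff (Nat.cast_ne_zero.2 (Nat.factorial_ne_zero _)), mul_div_assoc', div_mul_eq_mul_div,
    div_eq_iff (by exact_mod_cast Finset.prod_ne_zero_iff.2 fun s _ => Nat.factorial_ne_zero _)]
  push_cast at this
  linarith

lemma level_sum_succ {S : Type*} [Fintype S] (κ : S → S → ℝ) (hκsym : ∀ r s, κ r s = κ s r) (θ : S → ℝ) (n : ℕ) (r : S) :
    ∑ k ∈ Finset.piAntidiag (Finset.univ : Finset S) (n+1), (tau κ k * (k r : ℝ) *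
          ∏ s : S, θ s ^ (k s) / (Nat.factorial (k s) : ℝ))
      = rho (Sym2.lift ⟨κ, hκsym⟩) θ n r / (n.factorial : ℝ) := by
  rw [level_sum κ hκsym]
  have hR : ∀ i : Fin (n+1), RR (Sym2.lift ⟨κ, hκsym⟩) θ (Fin (n+1)) i r = RR (Sym2.lift ⟨κ, hκsym⟩) θ (Fin (n+1)) 0 r :=
    fun i => RR_fin _ θ i r n (by simp)
  rw [Finset.sum_congr rfl fun i _ => hR i]
  rw [Finset.sum_const, Finset.card_univ, Fintype.card_fin, nsmul_eq_mul, Nat.factorial_succ, rho]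
  have := Nat.cast_ne_zero (R := ℝ).2 (Nat.factorial_ne_zero n)
  push_cast
  field_simp

lemma hasSum_levels {S : Type*} [Fintype S] (f : (S → ℕ) → ℝ) (hf : ∀ k, 0 ≤ f k) (L : ℝ)
    (h0 : f 0 = 0)
    (h : HasSum (fun n => ∑ k ∈ Finset.piAntidiag (Finset.univ : Finset S) (n+1), f k) L) : HasSum f L := by
  have h' : HasSum (fun n => ∑ k ∈ Finset.piAntidiag (Finset.univ : Finset S) n, f k) L := by
    rw [← hasSum_nat_add_iff' 1]
    simpa [h0] using h
  have hfib : ∀ n : ℕ, ∀ k : S → ℕ, k ∈ Finset.piAntidiag (Finset.univ : Finset S) n ↔ ∑ s, k s = n := by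
    intro n k; simp [Finset.mem_piAntidiag]
  have hfs : ∀ n, HasSum (fun k : {k : S → ℕ // ∑ s, k s = n} => f k) (∑ k ∈ Finset.piAntidiag (Finset.univ : Finset S) n, f k) := by
    intro n
    have := Finset.hasSum (Finset.piAntidiag (Finset.univ : Finset S) n) f
    rw [← (Equiv.subtypeEquivRight (hfib n)).hasSum_iff]
    exact this
  rw [← (Equiv.sigmaFiberEquiv (fun k : S → ℕ => ∑ s, k s)).hasSum_iff]
  refine HasSum.sigma_of_hasSum h' (fun n => hfs n) ?_
  refine (summable_sigma_of_nonneg (fun _ => hf _)).2 ⟨fun n => (hfs n).summable, ?_⟩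
  refine h'.summable.congr fun n => (hfs n).tsum_eq.symm

/-- the tree series sums to the smallest solution of the characteristic
equation. -/
theorem tree_series_eq_min_solution
    {S : Type*} [Fintype S] [DecidableEq S] [Nonempty S]
    (κ : S → S → ℝ) (hκsym : ∀ r s, κ r s = κ s r) (hκ0 : ∀ r s, 0 ≤ κ r s)
    (ν : S → ℝ) (hν : ∀ s, 0 ≤ ν s) :
    ∃ νs : S → ℝ,
      ((∀ s, 0 ≤ νs s) ∧ (∀ s, νs s ≤ ν s) ∧
        (∀ s, νs s * Real.exp (-(∑ t : S, κ s t * νs t))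
            = ν s * Real.exp (-(∑ t : S, κ s t * ν t))) ∧
        ∀ ν' : S → ℝ, (∀ s, 0 ≤ ν' s) → (∀ s, ν' s ≤ ν s) →
          (∀ s, ν' s * Real.exp (-(∑ t : S, κ s t * ν' t))
              = ν s * Real.exp (-(∑ t : S, κ s t * ν t))) →
          ∀ s, νs s ≤ ν' s) ∧
      ∀ r, HasSum
        (fun k : S → ℕ => tau κ k * (k r : ℝ) *
          ∏ s : S, (ν s * Real.exp (-(∑ t : S, κ s t * ν t))) ^ (k s) /
            (Nat.factorial (k s) : ℝ))
        (νs r) := by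
  set θ : S → ℝ := fun s => ν s * Real.exp (-(∑ t : S, κ s t * ν t)) with hθd
  have hθ : ∀ s, 0 ≤ θ s := fun s => mul_nonneg (hν s) (Real.exp_pos _).le
  have hK : ∀ e, 0 ≤ Sym2.lift ⟨κ, hκsym⟩ e := fun e => by
    induction e with | h x y
    exact hκ0 x y
  set c : ℕ → S → ℝ := fun n r => rho (Sym2.lift ⟨κ, hκsym⟩) θ n r / (n.factorial : ℝ) with hcd
  have hc : ∀ n r, 0 ≤ c n r := fun n r => div_nonneg (rho_nonneg _ hK θ hθ n r) (Nat.cast_nonneg _)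
  have hc0 : ∀ r, c 0 r = θ r := fun r => by simp [hcd, rho_zero]
  have hrec : ∀ (n : ℕ) (r : S), ((n:ℝ) + 1) * c (n+1) r =
      ∑ p ∈ Finset.HasAntidiagonal.antidiagonal n, c p.1 r * (((p.2:ℝ) + 1) * ∑ s, κ r s * c p.2 s) :=
    fun n r => c_rec _ θ n r
  have hiff : ∀ a b x : ℝ, a * Real.exp (-x) = b ↔ a = b * Real.exp x := fun a b x => by
    rw [Real.exp_neg, ← div_eq_mul_inv, div_eq_iff (Real.exp_pos x).ne']
  have hpart := an_partial κ hκ0 θ hθ c hc hc0 hrec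
  have hbd := hpart ν hν (fun r => (hiff _ _ _).1 rfl)
  have hs : ∀ r, Summable fun n => c n r := fun r =>
    summable_of_sum_range_le (fun n => hc n r) (fun N => hbd N r)
  refine ⟨fun r => ∑' n, c n r, ⟨fun s => tsum_nonneg fun n => hc n s,
    fun s => Real.tsum_le_of_sum_range_le (fun n => hc n s) (fun N => hbd N s),
    fun s => (hiff _ _ _).2 (an_fix κ θ c hc hc0 hrec hs s), ?_⟩, ?_⟩
  · intro ν' h0 _ he s
    exact Real.tsum_le_of_sum_range_le (fun n => hc n s)
      (fun N => hpart ν' h0 (fun r => (hiff _ _ _).1 (he r)) N s)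
  · intro r
    refine hasSum_levels _ ?_ _ ?_ ?_
    · intro k
      refine mul_nonneg (mul_nonneg ?_ (Nat.cast_nonneg _)) (Finset.prod_nonneg fun s _ =>
        div_nonneg (pow_nonneg (hθ s) _) (Nat.cast_nonneg _))
      exact Finset.sum_nonneg fun E _ => Finset.prod_nonneg fun q _ => hκ0 _ _
    · simp
    · have h2 := (hs r).hasSum
      convert h2 using 2 with n
      exact level_sum_succ κ hκsym θ n r

end
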